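/- For every integer n ≥ 1, the following holds in the Laurent polynomial ring ℤ[p,q,q^{−1}]: Σ_{σ∈D_n} (−1)^{exc σ} p^{nest σ} q^{cros σ − exc σ} = 0 if n is odd, and Σ_{σ∈D_n} (−1)^{exc σ} p^{nest σ} q^{cros σ − exc σ} = (−1)^{n/2} q^{−n/2} · Σ_{σ∈D_{n,n/2}} p^{nest σ} q^{cros σ} if n is even, where D_{n,n/2} is the set of derangements of [n] with exactly n/2 cyclic valleys and no double excedances. -/

import Mathlib

open scoped Classical
open Finset

noncomputable section

namespace SZpaper

/-- `σ` as a 1-indexed function on `[1,n]`, extended by `0` elsewhere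
(boundary convention `σ(0)=σ(n+1)=0`). -/
def pext (n : ℕ) (σ : Equiv.Perm (Fin n)) (i : ℕ) : ℕ :=
  if h : 1 ≤ i ∧ i ≤ n then ((σ ⟨i - 1, by omega⟩ : Fin n) : ℕ) + 1 else 0

/-- `σ` extended with the Brändén boundary convention `σ(0)=σ(n+1)=n+1`. -/
def pextB (n : ℕ) (σ : Equiv.Perm (Fin n)) (i : ℕ) : ℕ :=
  if h : 1 ≤ i ∧ i ≤ n then ((σ ⟨i - 1, by omega⟩ : Fin n) : ℕ) + 1 else n + 1

/-- `σ` extended with the boundary convention `σ(0)=0`, `σ(n+1)=n+1`. -/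
def pextC (n : ℕ) (σ : Equiv.Perm (Fin n)) (i : ℕ) : ℕ :=
  if h : 1 ≤ i ∧ i ≤ n then ((σ ⟨i - 1, by omega⟩ : Fin n) : ℕ) + 1
  else if i = 0 then 0 else n + 1

/-- The set of pairs `(i,j)` with `i, j ∈ [1,n]`. -/
def pairs (n : ℕ) : Finset (ℕ × ℕ) := Finset.Icc 1 n ×ˢ Finset.Icc 1 n

/-- `des σ = #{i ∈ [n−1] : σ(i) > σ(i+1)}`. -/
def desStat (n : ℕ) (σ : Equiv.Perm (Fin n)) : ℕ :=
  ((Finset.Icc 1 (n - 1)).filter fun i => pext n σ (i + 1) < pext n σ i).card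

/-- `les σ = #{(i,j) : 2 ≤ i < j ≤ n, σ(i−1) > σ(j) > σ(i)}`. -/
def lesStat (n : ℕ) (σ : Equiv.Perm (Fin n)) : ℕ :=
  ((pairs n).filter fun x => 2 ≤ x.1 ∧ x.1 < x.2 ∧
    pext n σ x.1 < pext n σ x.2 ∧ pext n σ x.2 < pext n σ (x.1 - 1)).card

/-- `less σ = #{(i,j) : 2 ≤ i < j ≤ n, σ(i−1) < σ(j) < σ(i)}`. -/
def lessStat (n : ℕ) (σ : Equiv.Perm (Fin n)) : ℕ :=
  ((pairs n).filter fun x => 2 ≤ x.1 ∧ x.1 < x.2 ∧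
    pext n σ (x.1 - 1) < pext n σ x.2 ∧ pext n σ x.2 < pext n σ x.1).card

/-- `res σ = #{(i,j) : 1 ≤ i < j ≤ n−1, σ(j+1) > σ(i) > σ(j)}`. -/
def resStat (n : ℕ) (σ : Equiv.Perm (Fin n)) : ℕ :=
  ((pairs n).filter fun x => x.1 < x.2 ∧ x.2 ≤ n - 1 ∧
    pext n σ x.2 < pext n σ x.1 ∧ pext n σ x.1 < pext n σ (x.2 + 1)).card

/-- `ress σ = #{(i,j) : 1 ≤ i < j ≤ n−1, σ(j+1) < σ(i) < σ(j)}`. -/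
def ressStat (n : ℕ) (σ : Equiv.Perm (Fin n)) : ℕ :=
  ((pairs n).filter fun x => x.1 < x.2 ∧ x.2 ≤ n - 1 ∧
    pext n σ (x.2 + 1) < pext n σ x.1 ∧ pext n σ x.1 < pext n σ x.2).card

/-! Linear statistics with the boundary convention `σ(0)=σ(n+1)=0` (starred). -/

def peakStar (n : ℕ) (σ : Equiv.Perm (Fin n)) : ℕ :=
  ((Finset.Icc 1 n).filter fun i =>
    pext n σ (i - 1) < pext n σ i ∧ pext n σ (i + 1) < pext n σ i).card

def valleyStar (n : ℕ) (σ : Equiv.Perm (Fin n)) : ℕ :=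
  ((Finset.Icc 1 n).filter fun i =>
    pext n σ i < pext n σ (i - 1) ∧ pext n σ i < pext n σ (i + 1)).card

def daStar (n : ℕ) (σ : Equiv.Perm (Fin n)) : ℕ :=
  ((Finset.Icc 1 n).filter fun i =>
    pext n σ (i - 1) < pext n σ i ∧ pext n σ i < pext n σ (i + 1)).card

def ddStar (n : ℕ) (σ : Equiv.Perm (Fin n)) : ℕ :=
  ((Finset.Icc 1 n).filter fun i =>
    pext n σ (i + 1) < pext n σ i ∧ pext n σ i < pext n σ (i - 1)).card

/-! Linear statistics with the Brändén boundary convention `σ(0)=σ(n+1)=n+1`. -/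

def peakB (n : ℕ) (σ : Equiv.Perm (Fin n)) : ℕ :=
  ((Finset.Icc 1 n).filter fun i =>
    pextB n σ (i - 1) < pextB n σ i ∧ pextB n σ (i + 1) < pextB n σ i).card

def valleyB (n : ℕ) (σ : Equiv.Perm (Fin n)) : ℕ :=
  ((Finset.Icc 1 n).filter fun i =>
    pextB n σ i < pextB n σ (i - 1) ∧ pextB n σ i < pextB n σ (i + 1)).card

def daB (n : ℕ) (σ : Equiv.Perm (Fin n)) : ℕ :=
  ((Finset.Icc 1 n).filter fun i =>
    pextB n σ (i - 1) < pextB n σ i ∧ pextB n σ i < pextB n σ (i + 1)).card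

def ddB (n : ℕ) (σ : Equiv.Perm (Fin n)) : ℕ :=
  ((Finset.Icc 1 n).filter fun i =>
    pextB n σ (i + 1) < pextB n σ i ∧ pextB n σ i < pextB n σ (i - 1)).card

/-! Linear statistics with the boundary convention `σ(0)=0`, `σ(n+1)=n+1`. -/

def valleyC (n : ℕ) (σ : Equiv.Perm (Fin n)) : ℕ :=
  ((Finset.Icc 1 n).filter fun i =>
    pextC n σ i < pextC n σ (i - 1) ∧ pextC n σ i < pextC n σ (i + 1)).card

def daC (n : ℕ) (σ : Equiv.Perm (Fin n)) : ℕ :=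
  ((Finset.Icc 1 n).filter fun i =>
    pextC n σ (i - 1) < pextC n σ i ∧ pextC n σ i < pextC n σ (i + 1)).card

def ddC (n : ℕ) (σ : Equiv.Perm (Fin n)) : ℕ :=
  ((Finset.Icc 1 n).filter fun i =>
    pextC n σ (i + 1) < pextC n σ i ∧ pextC n σ i < pextC n σ (i - 1)).card

/-- `fmax σ`: the number of double ascents (convention `σ(0)=0`, `σ(n+1)=n+1`)
which are left-to-right maxima. -/
def fmaxStat (n : ℕ) (σ : Equiv.Perm (Fin n)) : ℕ :=
  ((Finset.Icc 1 n).filter fun i =>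
    pextC n σ (i - 1) < pextC n σ i ∧ pextC n σ i < pextC n σ (i + 1) ∧
    ∀ j ∈ Finset.Ico 1 i, pext n σ j < pext n σ i).card

/-! Cyclic statistics. -/

def excStat (n : ℕ) (σ : Equiv.Perm (Fin n)) : ℕ :=
  ((Finset.Icc 1 n).filter fun i => i < pext n σ i).card

def wexStat (n : ℕ) (σ : Equiv.Perm (Fin n)) : ℕ :=
  ((Finset.Icc 1 n).filter fun i => i ≤ pext n σ i).card

def dropStat (n : ℕ) (σ : Equiv.Perm (Fin n)) : ℕ :=
  ((Finset.Icc 1 n).filter fun i => pext n σ i < i).card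

def fixStat (n : ℕ) (σ : Equiv.Perm (Fin n)) : ℕ :=
  ((Finset.Icc 1 n).filter fun i => pext n σ i = i).card

/-- cyclic valleys: `x` with `σ⁻¹(x) > x < σ(x)`. -/
def cvalleyStat (n : ℕ) (σ : Equiv.Perm (Fin n)) : ℕ :=
  ((Finset.Icc 1 n).filter fun x => x < pext n σ⁻¹ x ∧ x < pext n σ x).card

/-- double excedances: `x` with `σ⁻¹(x) < x < σ(x)`. -/
def cdaStat (n : ℕ) (σ : Equiv.Perm (Fin n)) : ℕ :=
  ((Finset.Icc 1 n).filter fun x => pext n σ⁻¹ x < x ∧ x < pext n σ x).card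

/-- double drops: `x` with `σ⁻¹(x) > x > σ(x)`. -/
def cddStat (n : ℕ) (σ : Equiv.Perm (Fin n)) : ℕ :=
  ((Finset.Icc 1 n).filter fun x => x < pext n σ⁻¹ x ∧ pext n σ x < x).card

/-- crossings. -/
def crosStat (n : ℕ) (σ : Equiv.Perm (Fin n)) : ℕ :=
  ((pairs n).filter fun x =>
    (x.1 < x.2 ∧ x.2 ≤ pext n σ x.1 ∧ pext n σ x.1 < pext n σ x.2) ∨
    (x.2 < x.1 ∧ pext n σ x.1 < x.2 ∧ pext n σ x.2 < pext n σ x.1)).card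

/-- nestings. -/
def nestStat (n : ℕ) (σ : Equiv.Perm (Fin n)) : ℕ :=
  ((pairs n).filter fun x =>
    (x.1 < x.2 ∧ x.2 ≤ pext n σ x.2 ∧ pext n σ x.2 < pext n σ x.1) ∨
    (x.2 < x.1 ∧ pext n σ x.2 < x.2 ∧ pext n σ x.1 < pext n σ x.2)).card

/-- number of cycles of `σ` (fixed points count as cycles). -/
def cycStat (n : ℕ) (σ : Equiv.Perm (Fin n)) : ℕ :=
  Multiset.card σ.cycleType + (Finset.univ.filter fun x => σ x = x).card

/-! Star statistics: `σ*(i) = σ(i) − 1`, a bijection `[n] → {0,…,n−1}`;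
we extend `σ*` by `0` outside `[1,n]`. -/

def starf (n : ℕ) (σ : Equiv.Perm (Fin n)) (i : ℕ) : ℕ :=
  if 1 ≤ i ∧ i ≤ n then pext n σ i - 1 else 0

/-- `(σ*)⁻¹(i) = σ⁻¹(i+1)`, defined for `0 ≤ i ≤ n−1`. -/
def invstarf (n : ℕ) (σ : Equiv.Perm (Fin n)) (i : ℕ) : ℕ :=
  pext n σ⁻¹ (i + 1)

def dropStarStat (n : ℕ) (σ : Equiv.Perm (Fin n)) : ℕ :=
  ((Finset.Icc 1 n).filter fun i => starf n σ i < i).card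

def fixStarStat (n : ℕ) (σ : Equiv.Perm (Fin n)) : ℕ :=
  ((Finset.Icc 1 n).filter fun i => starf n σ i = i).card

def wexStarStat (n : ℕ) (σ : Equiv.Perm (Fin n)) : ℕ :=
  ((Finset.Icc 1 n).filter fun i => i ≤ starf n σ i).card

def cdaStarStat (n : ℕ) (σ : Equiv.Perm (Fin n)) : ℕ :=
  ((Finset.Icc 1 n).filter fun i => invstarf n σ i < i ∧ i < starf n σ i).card

def cddStarStat (n : ℕ) (σ : Equiv.Perm (Fin n)) : ℕ :=
  ((Finset.Icc 1 n).filter fun i => i < invstarf n σ i ∧ starf n σ i < i).card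

def cvalleyStarStat (n : ℕ) (σ : Equiv.Perm (Fin n)) : ℕ :=
  ((Finset.Icc 1 n).filter fun i => i < invstarf n σ i ∧ i < starf n σ i).card

def crosStarStat (n : ℕ) (σ : Equiv.Perm (Fin n)) : ℕ :=
  ((pairs n).filter fun x =>
    (x.1 < x.2 ∧ x.2 ≤ starf n σ x.1 ∧ starf n σ x.1 < starf n σ x.2) ∨
    (x.2 < x.1 ∧ starf n σ x.1 < x.2 ∧ starf n σ x.2 < starf n σ x.1)).card

def nestStarStat (n : ℕ) (σ : Equiv.Perm (Fin n)) : ℕ :=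
  ((pairs n).filter fun x =>
    (x.1 < x.2 ∧ x.2 ≤ starf n σ x.2 ∧ starf n σ x.2 < starf n σ x.1) ∨
    (x.2 < x.1 ∧ starf n σ x.2 < x.2 ∧ starf n σ x.1 < starf n σ x.2)).card

/-- `cyc* σ`: the number of cycles of the functional digraph of `σ*` on `[n]`,
counted as the number of `i ∈ [1,n]` that lie on a cycle of `σ*` and are
minimal in their cycle. (The component of `σ*` that is a path from `n` to `0`
contributes no such `i`.) -/
def cycStarStat (n : ℕ) (σ : Equiv.Perm (Fin n)) : ℕ :=
  ((Finset.Icc 1 n).filter fun i =>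
    (∃ m ∈ Finset.Icc 1 n, (starf n σ)^[m] i = i) ∧
    ∀ m ∈ Finset.range (n + 1), i ≤ (starf n σ)^[m] i).card

/-! Motzkin paths, encoded as step sequences `γ : Fin m → Fin 3`
(`0` = up step `(1,1)`, `1` = level step `(1,0)`, `2` = down step `(1,−1)`). -/

/-- The height (ordinate) of the path after `i` steps. -/
def hgt (m : ℕ) (γ : Fin m → Fin 3) (i : ℕ) : ℤ :=
  ∑ j ∈ Finset.range i, if hj : j < m then 1 - ((γ ⟨j, hj⟩ : ℕ) : ℤ) else 0

/-- A step sequence is a Motzkin path if it never goes below the x-axis and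
ends at height `0`. -/
def IsMotzkin (m : ℕ) (γ : Fin m → Fin 3) : Prop :=
  (∀ i ≤ m, 0 ≤ hgt m γ i) ∧ hgt m γ m = 0

/-- The (finite) set of Motzkin paths of length `m`. -/
def motzkin (m : ℕ) : Finset (Fin m → Fin 3) :=
  Finset.univ.filter fun γ => IsMotzkin m γ

/-- number of up (North-East) steps. -/
def neCount (m : ℕ) (γ : Fin m → Fin 3) : ℕ :=
  (Finset.univ.filter fun i => γ i = 0).card

/-- number of level (East) steps. -/
def eCount (m : ℕ) (γ : Fin m → Fin 3) : ℕ :=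
  (Finset.univ.filter fun i => γ i = 1).card

/-- the `(p,q)`-integer `[m]_{p,q} = p^{m−1} + p^{m−2}q + ⋯ + q^{m−1}`. -/
def pqInt {R : Type*} [CommRing R] (p q : R) (m : ℕ) : R :=
  ∑ j ∈ Finset.range m, p ^ (m - 1 - j) * q ^ j

open LaurentPolynomial in
/-- The variable `p` in the Laurent-polynomial ring `ℤ[p][q,q⁻¹]`. -/
def pL : LaurentPolynomial (Polynomial ℤ) := LaurentPolynomial.C Polynomial.X

/-- The sources `i < y` whose image under `σ` is at least `y`. -/
def openSources {n : ℕ} (σ : Equiv.Perm (Fin n)) (y : Fin n) : Finset (Fin n) :=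
  Finset.univ.filter fun i => i < y ∧ y ≤ σ i

/-- `∑ i < k, p ^ i * q ^ (k - 1 - i)`, in recursive form. -/
def homSum {R : Type*} [CommRing R] (p q : R) : ℕ → R
  | 0 => 0
  | k + 1 => q * homSum p q k + p ^ k

theorem sum_rank_weight {R : Type*} [CommRing R] (p q : R) {α : Type*} [LinearOrder α]
    (S : Finset α) :
    ∑ a ∈ S, p ^ (S.filter (· < a)).card * q ^ (S.filter (a < ·)).card = homSum p q S.card := by
  induction S using Finset.induction_on_max with
  | empty => simp [homSum]
  | insert m S hm ih =>
    have hmS : m ∉ S := fun h => lt_irrefl _ (hm m h)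
    rw [Finset.sum_insert hmS, Finset.card_insert_of_notMem hmS, homSum, ← ih, Finset.mul_sum,
      add_comm]
    congr 1
    · refine Finset.sum_congr rfl fun a ha => ?_
      rw [Finset.filter_insert, Finset.filter_insert, if_neg (hm a ha).not_gt, if_pos (hm a ha),
        Finset.card_insert_of_notMem (by simp [hmS]), pow_succ]
      ring
    · have h1 : (insert m S).filter (· < m) = S := by
        ext i
        simp only [mem_filter, mem_insert]
        constructor
        · rintro ⟨rfl | h, h'⟩
          · exact absurd h' (lt_irrefl _)
          · exact h
        · exact fun h => ⟨Or.inr h, hm i h⟩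
      have h2 : (insert m S).filter (m < ·) = ∅ := by
        ext i
        simp only [mem_filter, mem_insert, notMem_empty, iff_false]
        rintro ⟨rfl | h, h'⟩
        · exact lt_irrefl _ h'
        · exact lt_asymm h' (hm i h)
      rw [h1, h2]; simp

/-- The weight of closing an arc with endpoint `a` chosen among the open endpoints `S` at `y`;
the value `a = y` means that no arc is closed. -/
def closeWeight {R : Type*} [CommRing R] (p q : R) {n : ℕ} (S : Finset (Fin n))
    (y a : Fin n) : R :=
  if a = y then 1 else p ^ (S.filter (· < a)).card * q ^ (S.filter (a < ·)).card

/-- The weight of the type of `y`: valley, double drop (`d`), double excedance (`u`), peak (`v`). -/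
def typeWeight {R : Type*} [CommRing R] (u d v : R) {n : ℕ} (y a b : Fin n) : R :=
  if a = y then (if b = y then 1 else d) else (if b = y then u else v)

/-- The weight of `σ` at the element `y`. -/
def localWeight {R : Type*} [CommRing R] (p q u d v : R) {n : ℕ} (σ : Equiv.Perm (Fin n))
    (y : Fin n) : R :=
  closeWeight p q (openSources σ y) y (min (σ⁻¹ y) y) *
    closeWeight p q (openSources σ⁻¹ y) y (min (σ y) y) *
    typeWeight u d v y (min (σ⁻¹ y) y) (min (σ y) y)

/-- The weight of all completions with `r` remaining elements and `k` open arcs, where `s` is the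
weight of a transient element and `v` the one of a peak. -/
def completionWeight {R : Type*} [CommRing R] (p q s v : R) : ℕ → ℕ → R
  | 0, k => if k = 0 then 1 else 0
  | r + 1, k => completionWeight p q s v r (k + 1) +
      s * homSum p q k * completionWeight p q s v r k +
      v * homSum p q k ^ 2 * completionWeight p q s v r (k - 1)

/-- `f` is, off the diagonal, a partial injection of the elements smaller than `m`. -/
structure IsPartialInj {n : ℕ} (m : ℕ) (f : Fin n → Fin n → Prop) : Prop where
  lt_left : ∀ {i j}, f i j → (i : ℕ) < m
  lt_right : ∀ {i j}, f i j → (j : ℕ) < m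
  right_unique : ∀ {i j k}, f i j → f i k → i ≠ j → i ≠ k → j = k
  left_unique : ∀ {i j k}, f i k → f j k → i ≠ k → j ≠ k → i = j

/-- The elements smaller than `m` without an image under the partial injection `f`. -/
def unmatched {n : ℕ} (m : ℕ) (f : Fin n → Fin n → Prop) : Finset (Fin n) :=
  Finset.univ.filter fun i => (i : ℕ) < m ∧ ∀ j, i ≠ j → ¬ f i j

/-- The derangements whose restriction to the elements smaller than `m` is `f`. -/
def extensions {n : ℕ} (m : ℕ) (f : Fin n → Fin n → Prop) : Finset (Equiv.Perm (Fin n)) :=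
  Finset.univ.filter fun σ => (∀ i, σ i ≠ i) ∧
    ∀ i j : Fin n, (i : ℕ) < m → (j : ℕ) < m → i ≠ j → (f i j ↔ σ i = j)

/-- Add the arcs `a → x` and `x → b` to `f`; an arc `x → x` is immaterial. -/
def extendAt {n : ℕ} (f : Fin n → Fin n → Prop) (x a b : Fin n) : Fin n → Fin n → Prop :=
  fun i j => f i j ∨ (i = a ∧ j = x) ∨ (i = x ∧ j = b)

theorem IsPartialInj.swap {n m : ℕ} {f : Fin n → Fin n → Prop} (h : IsPartialInj m f) :
    IsPartialInj m (Function.swap f) where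
  lt_left := h.lt_right
  lt_right := h.lt_left
  right_unique h1 h2 h3 h4 := h.left_unique h1 h2 h3.symm h4.symm
  left_unique h1 h2 h3 h4 := h.right_unique h1 h2 h3.symm h4.symm

theorem swap_extendAt {n : ℕ} (f : Fin n → Fin n → Prop) (x a b : Fin n) :
    Function.swap (extendAt f x a b) = extendAt (Function.swap f) x b a := by
  funext i j
  simp only [Function.swap, extendAt, eq_iff_iff]
  tauto

theorem mem_unmatched {n m : ℕ} {f : Fin n → Fin n → Prop} {i : Fin n} :
    i ∈ unmatched m f ↔ (i : ℕ) < m ∧ ∀ j, i ≠ j → ¬ f i j := by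
  simp [unmatched]

theorem mem_extensions {n m : ℕ} {f : Fin n → Fin n → Prop} {σ : Equiv.Perm (Fin n)} :
    σ ∈ extensions m f ↔ (∀ i, σ i ≠ i) ∧
      ∀ i j : Fin n, (i : ℕ) < m → (j : ℕ) < m → i ≠ j → (f i j ↔ σ i = j) := by
  simp [extensions]

theorem inv_mem_extensions {n m : ℕ} {f : Fin n → Fin n → Prop} {σ : Equiv.Perm (Fin n)}
    (h : σ ∈ extensions m f) : σ⁻¹ ∈ extensions m (Function.swap f) := by
  rw [mem_extensions] at h ⊢
  refine ⟨fun i hi => h.1 i ?_, fun i j hi hj hij => ?_⟩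
  · rw [Equiv.Perm.inv_eq_iff_eq] at hi; exact hi.symm
  · rw [Equiv.Perm.inv_eq_iff_eq, Function.swap, h.2 j i hj hi hij.symm, eq_comm]

theorem openSources_eq {n : ℕ} {x : Fin n} {f : Fin n → Fin n → Prop} (hf : IsPartialInj x f)
    {σ : Equiv.Perm (Fin n)} (h : σ ∈ extensions (x : ℕ) f) :
    openSources σ x = unmatched x f := by
  rw [mem_extensions] at h
  ext i
  rw [mem_unmatched]
  simp only [openSources, mem_filter, mem_univ, true_and]
  refine and_congr_right fun hi => ⟨fun hx j hij hfj => ?_, fun hx => ?_⟩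
  · have := (h.2 i j hi (hf.lt_right hfj) hij).1 hfj
    have := hf.lt_right hfj
    omega
  · by_contra hlt
    push Not at hlt
    exact hx (σ i) (h.1 i).symm ((h.2 i (σ i) hi hlt (h.1 i).symm).2 rfl)

theorem min_mem_insert_unmatched {n : ℕ} {x : Fin n} {f : Fin n → Fin n → Prop}
    (hf : IsPartialInj x f) {σ : Equiv.Perm (Fin n)} (h : σ ∈ extensions (x : ℕ) f) :
    min (σ⁻¹ x) x ∈ insert x (unmatched x f) := by
  rw [← openSources_eq hf h]
  simp only [openSources, mem_filter, mem_univ, true_and, mem_insert]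
  rcases lt_or_ge (σ⁻¹ x) x with h1 | h1
  · right; rw [min_eq_left h1.le]; exact ⟨h1, by simp⟩
  · left; exact min_eq_right h1

theorem mem_extensions_extendAt {n : ℕ} {x a b : Fin n} {f : Fin n → Fin n → Prop}
    (hf : IsPartialInj x f) (ha : a ≤ x) (hb : b ≤ x) (σ : Equiv.Perm (Fin n)) :
    σ ∈ extensions ((x : ℕ) + 1) (extendAt f x a b) ↔
      σ ∈ extensions (x : ℕ) f ∧ min (σ⁻¹ x) x = a ∧ min (σ x) x = b := by
  have key : ∀ i : Fin n, σ i = x ↔ σ⁻¹ x = i := fun i => by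
    rw [Equiv.Perm.inv_eq_iff_eq, eq_comm]
  constructor
  · intro h
    rw [mem_extensions] at h
    obtain ⟨hd, h⟩ := h
    refine ⟨mem_extensions.2 ⟨hd, fun i j hi hj hij => ?_⟩, ?_, ?_⟩
    · rw [← h i j (by omega) (by omega) hij, extendAt]
      constructor
      · exact Or.inl
      · rintro (h1 | ⟨-, rfl⟩ | ⟨rfl, -⟩)
        · exact h1
        · omega
        · omega
    · rcases ha.lt_or_eq with ha | rfl
      · have := (h a x (by omega) (by omega) ha.ne).1 (Or.inr (Or.inl ⟨rfl, rfl⟩))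
        rw [(key a).1 this, min_eq_left ha.le]
      · refine min_eq_right (not_lt.1 fun hlt => ?_)
        rcases (h (σ⁻¹ a) a (by omega) (by omega) hlt.ne).2 (by simp) with h1 | ⟨h1, -⟩ | ⟨h1, -⟩
        · exact lt_irrefl _ (hf.lt_right h1)
        · exact hlt.ne h1
        · exact hlt.ne h1
    · rcases hb.lt_or_eq with hb | rfl
      · have := (h x b (by omega) (by omega) hb.ne').1 (Or.inr (Or.inr ⟨rfl, rfl⟩))
        rw [this, min_eq_left hb.le]
      · refine min_eq_right (not_lt.1 fun hlt => ?_)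
        rcases (h b (σ b) (by omega) (by omega) hlt.ne').2 rfl with h1 | ⟨-, h1⟩ | ⟨-, h1⟩
        · exact lt_irrefl _ (hf.lt_left h1)
        · exact hlt.ne h1
        · exact hlt.ne h1
  · rintro ⟨h, rfl, rfl⟩
    rw [mem_extensions] at h ⊢
    refine ⟨h.1, fun i j hi hj hij => ?_⟩
    have hjx : j < x ∨ j = x := by omega
    rcases (show i < x ∨ i = x by omega) with hi' | rfl <;> rcases hjx with hj' | rfl
    · rw [← h.2 i j hi' hj' hij, extendAt]
      constructor
      · rintro (h1 | ⟨-, rfl⟩ | ⟨rfl, -⟩)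
        · exact h1
        · omega
        · omega
      · exact Or.inl
    · rw [key, extendAt]
      constructor
      · rintro (h1 | ⟨h1, -⟩ | ⟨h1, -⟩)
        · exact absurd (hf.lt_right h1) (lt_irrefl _)
        · rcases min_choice (σ⁻¹ j) j with h2 | h2 <;> rw [h2] at h1
          · exact h1.symm
          · exact absurd h1 hij
        · exact absurd h1 hij
      · rintro rfl
        exact Or.inr (Or.inl ⟨(min_eq_left hi'.le).symm, rfl⟩)
    · rw [extendAt]
      constructor
      · rintro (h1 | ⟨-, h1⟩ | ⟨-, h1⟩)
        · exact absurd (hf.lt_left h1) (lt_irrefl _)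
        · exact absurd h1.symm hij
        · rcases min_choice (σ i) i with h2 | h2 <;> rw [h2] at h1
          · exact h1.symm
          · exact absurd h1.symm hij
      · rintro rfl
        exact Or.inr (Or.inr ⟨rfl, (min_eq_left hj'.le).symm⟩)
    · exact absurd rfl hij

theorem IsPartialInj.right_unique_extendAt {n : ℕ} {x a b : Fin n} {f : Fin n → Fin n → Prop}
    (hf : IsPartialInj x f) (ha : a ∈ insert x (unmatched x f)) {i j k : Fin n}
    (h1 : extendAt f x a b i j) (h2 : extendAt f x a b i k) (hij : i ≠ j) (hik : i ≠ k) :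
    j = k := by
  have hx : ∀ {j}, ¬ f x j := fun h => lt_irrefl _ (hf.lt_left h)
  rw [mem_insert, mem_unmatched] at ha
  rcases h1 with h1 | ⟨rfl, rfl⟩ | ⟨rfl, rfl⟩ <;> rcases h2 with h2 | ⟨h2, h3⟩ | ⟨h2, h3⟩
  · exact hf.right_unique h1 h2 hij hik
  · subst h2 h3
    rcases ha with ha | ha
    · exact absurd ha hik
    · exact absurd h1 (ha.2 _ hij)
  · subst h2; exact absurd h1 hx
  · rcases ha with ha | ha
    · exact absurd ha hij
    · exact absurd h2 (ha.2 _ hik)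
  · exact h3.symm
  · exact absurd h2 hij
  · exact absurd h2 hx
  · exact absurd h3.symm hik
  · exact h3.symm

theorem IsPartialInj.extendAt {n : ℕ} {x a b : Fin n} {f : Fin n → Fin n → Prop}
    (hf : IsPartialInj x f) (ha : a ∈ insert x (unmatched x f))
    (hb : b ∈ insert x (unmatched x (Function.swap f))) :
    IsPartialInj ((x : ℕ) + 1) (extendAt f x a b) := by
  have ha' : (a : ℕ) < x + 1 := by
    rw [mem_insert, mem_unmatched] at ha
    rcases ha with rfl | ha <;> omega
  have hb' : (b : ℕ) < x + 1 := by
    rw [mem_insert, mem_unmatched] at hb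
    rcases hb with rfl | hb <;> omega
  refine ⟨?_, ?_, hf.right_unique_extendAt ha, ?_⟩
  · rintro i j (h | ⟨rfl, rfl⟩ | ⟨rfl, rfl⟩)
    · have := hf.lt_left h; omega
    · exact ha'
    · omega
  · rintro i j (h | ⟨rfl, rfl⟩ | ⟨rfl, rfl⟩)
    · have := hf.lt_right h; omega
    · omega
    · exact hb'
  · intro i j k h1 h2 h3 h4
    refine hf.swap.right_unique_extendAt (a := b) (b := a) hb (i := k) ?_ ?_ h3.symm h4.symm
    · rw [← swap_extendAt]; exact h1
    · rw [← swap_extendAt]; exact h2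

theorem card_unmatched_extendAt {n : ℕ} {x a b : Fin n} {f : Fin n → Fin n → Prop}
    (hf : IsPartialInj x f) (ha : a ∈ insert x (unmatched x f)) :
    (unmatched ((x : ℕ) + 1) (extendAt f x a b)).card =
      (unmatched x f).card + (if a = x then 1 else 0) + (if b = x then 1 else 0) - 1 := by
  have hx : x ∉ unmatched x f := fun h => lt_irrefl _ (mem_unmatched.1 h).1
  have hxj : ∀ {j}, ¬ f x j := fun h => lt_irrefl _ (hf.lt_left h)
  have hset : unmatched ((x : ℕ) + 1) (extendAt f x a b) =
      if b = x then insert x ((unmatched x f).erase a) else (unmatched x f).erase a := by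
    ext i
    have hmem : i ∈ unmatched ((x : ℕ) + 1) (extendAt f x a b) ↔
        (i = x ∧ b = x) ∨ (i ≠ a ∧ i ∈ unmatched x f) := by
      simp only [mem_unmatched]
      constructor
      · rintro ⟨hi, h⟩
        rcases (show i < x ∨ i = x by omega) with hi' | rfl
        · exact Or.inr ⟨fun hia => h x hi'.ne (Or.inr (Or.inl ⟨hia, rfl⟩)), hi',
            fun j hj hfj => h j hj (Or.inl hfj)⟩
        · refine Or.inl ⟨rfl, by_contra fun hb => h b (Ne.symm hb) (Or.inr (Or.inr ⟨rfl, rfl⟩))⟩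
      · rintro (⟨rfl, rfl⟩ | ⟨hia, hi, h⟩)
        · refine ⟨by omega, fun j hj => ?_⟩
          rintro (h | ⟨-, h⟩ | ⟨-, h⟩)
          · exact hxj h
          · exact hj h.symm
          · exact hj h.symm
        · refine ⟨by omega, fun j hj => ?_⟩
          rintro (h1 | ⟨h1, -⟩ | ⟨h1, -⟩)
          · exact h j hj h1
          · exact hia h1
          · subst h1; omega
    rw [hmem]
    split_ifs with hb <;> simp [hb]
  rw [hset]
  have hxe : x ∉ (unmatched x f).erase a := fun h => hx (mem_of_mem_erase h)
  rw [mem_insert] at ha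
  by_cases hax : a = x
  · subst hax
    rw [erase_eq_of_notMem hx, if_pos rfl]
    split_ifs <;> simp [hx]
  · have hau := ha.resolve_left hax
    have := card_pos.2 ⟨a, hau⟩
    split_ifs
    · rw [card_insert_of_notMem hxe, card_erase_of_mem hau]; omega
    · rw [card_erase_of_mem hau]; omega

theorem sum_step_weight {R : Type*} [CommRing R] (p q u d v : R) {n : ℕ} (x : Fin n)
    {S T : Finset (Fin n)} (hS : x ∉ S) (hT : x ∉ T) (hST : T.card = S.card) (r : ℕ) :
    ∑ c ∈ insert x S ×ˢ insert x T,
      closeWeight p q S x c.1 * closeWeight p q T x c.2 * typeWeight u d v x c.1 c.2 *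
        completionWeight p q (u + d) v r
          (S.card + (if c.1 = x then 1 else 0) + (if c.2 = x then 1 else 0) - 1) =
      completionWeight p q (u + d) v (r + 1) S.card := by
  have hne : ∀ {U : Finset (Fin n)}, x ∉ U → ∀ a ∈ U, a ≠ x := by
    rintro U hU a ha rfl; exact hU ha
  have hclose : ∀ {U : Finset (Fin n)}, x ∉ U →
      ∑ a ∈ U, closeWeight p q U x a = homSum p q U.card := by
    intro U hU
    rw [← sum_rank_weight]
    exact sum_congr rfl fun a ha => if_neg (hne hU a ha)
  rw [sum_product, sum_insert hS, sum_insert hT]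
  have h1 : ∀ b ∈ T, closeWeight p q S x x * closeWeight p q T x b * typeWeight u d v x x b *
        completionWeight p q (u + d) v r
          (S.card + (if x = x then 1 else 0) + (if b = x then 1 else 0) - 1) =
      closeWeight p q T x b * (d * completionWeight p q (u + d) v r S.card) := by
    intro b hb
    simp [closeWeight, typeWeight, hne hT b hb]; ring
  have h2 : ∀ a ∈ S, ∑ b ∈ insert x T,
      closeWeight p q S x a * closeWeight p q T x b * typeWeight u d v x a b *
        completionWeight p q (u + d) v r
          (S.card + (if a = x then 1 else 0) + (if b = x then 1 else 0) - 1) =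
      closeWeight p q S x a * (u * completionWeight p q (u + d) v r S.card +
        v * homSum p q S.card * completionWeight p q (u + d) v r (S.card - 1)) := by
    intro a ha
    rw [sum_insert hT, mul_add]
    congr 1
    · simp [closeWeight, typeWeight, hne hS a ha]; ring
    · rw [← hST, ← hclose hT, mul_sum, sum_mul, mul_sum]
      refine sum_congr rfl fun b hb => ?_
      simp only [typeWeight, hne hS a ha, hne hT b hb, if_false, add_zero]
      ring
  rw [sum_congr rfl h1, sum_congr rfl h2, ← sum_mul, ← sum_mul, hclose hS, hclose hT, hST,
    completionWeight]
  simp [closeWeight, typeWeight]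
  ring

theorem sum_extensions_full {R : Type*} [CommRing R] {n : ℕ} {f : Fin n → Fin n → Prop}
    (hf : IsPartialInj n f) :
    ∑ _σ ∈ extensions n f, (1 : R) = if (unmatched n f).card = 0 then 1 else 0 := by
  split_ifs with h
  · have hex : ∀ i, ∃ j, i ≠ j ∧ f i j := by
      intro i
      have : i ∉ unmatched n f := by rw [card_eq_zero.1 h]; simp
      rw [mem_unmatched] at this
      push Not at this
      exact this i.2
    choose g hg using hex
    have hinj : Function.Injective g := fun i j hij =>
      hf.left_unique (hg i).2 (hij ▸ (hg j).2) (hg i).1 (hij ▸ (hg j).1)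
    have : extensions n f = {Equiv.ofBijective g (Finite.injective_iff_bijective.1 hinj)} := by
      ext σ
      rw [mem_extensions, mem_singleton]
      constructor
      · rintro ⟨-, hσ⟩
        ext i : 1
        exact (hσ i (g i) i.2 (g i).2 (hg i).1).1 (hg i).2
      · rintro rfl
        refine ⟨fun i => (hg i).1.symm, fun i j _ _ hij => ⟨fun h => ?_, ?_⟩⟩
        · exact hf.right_unique (hg i).2 h (hg i).1 hij
        · rintro rfl; exact (hg i).2
    rw [this, sum_singleton]
  · obtain ⟨i, hi⟩ := card_ne_zero.1 h
    rw [mem_unmatched] at hi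
    have : extensions n f = ∅ := by
      refine eq_empty_of_forall_notMem fun σ hσ => ?_
      rw [mem_extensions] at hσ
      exact hi.2 (σ i) (hσ.1 i).symm ((hσ.2 i (σ i) i.2 (σ i).2 (hσ.1 i).symm).2 rfl)
    rw [this, sum_empty]

theorem sum_extensions_eq {R : Type*} [CommRing R] (p q u d v : R) {n : ℕ} (r : ℕ) :
    ∀ (m : ℕ) (f : Fin n → Fin n → Prop), m + r = n → IsPartialInj m f →
      (unmatched m (Function.swap f)).card = (unmatched m f).card →
      ∑ σ ∈ extensions m f, ∏ y ∈ univ.filter (fun y : Fin n => m ≤ (y : ℕ)),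
        localWeight p q u d v σ y =
      completionWeight p q (u + d) v r (unmatched m f).card := by
  induction r with
  | zero =>
    intro m f hm hf _
    obtain rfl : m = n := by omega
    rw [completionWeight, ← sum_extensions_full hf]
    refine sum_congr rfl fun σ _ => ?_
    rw [filter_false_of_mem fun y _ => by omega, prod_empty]
  | succ r ih =>
    intro m f hm hf hcard
    obtain ⟨x, rfl⟩ : ∃ x : Fin n, (x : ℕ) = m := ⟨⟨m, by omega⟩, rfl⟩
    have hxS : x ∉ unmatched x f := fun h => lt_irrefl _ (mem_unmatched.1 h).1
    have hxT : x ∉ unmatched x (Function.swap f) := fun h => lt_irrefl _ (mem_unmatched.1 h).1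
    rw [← sum_step_weight p q u d v x hxS hxT hcard,
      ← sum_fiberwise_of_maps_to (g := fun σ : Equiv.Perm (Fin n) => (min (σ⁻¹ x) x, min (σ x) x))
        (t := insert x (unmatched x f) ×ˢ insert x (unmatched x (Function.swap f)))]
    · refine sum_congr rfl fun c hc => ?_
      obtain ⟨a, b⟩ := c
      obtain ⟨ha, hb⟩ := mem_product.1 hc
      simp only at ha hb
      have hle : ∀ {g : Fin n → Fin n → Prop} {a}, a ∈ insert x (unmatched x g) → a ≤ x := by
        intro g a h
        rw [mem_insert, mem_unmatched] at h
        rcases h with rfl | h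
        · exact le_rfl
        · exact h.1.le
      have hext : (extensions (x : ℕ) f).filter
          (fun σ => (min (σ⁻¹ x) x, min (σ x) x) = (a, b)) =
          extensions ((x : ℕ) + 1) (extendAt f x a b) := by
        ext σ
        rw [mem_filter, mem_extensions_extendAt hf (hle ha) (hle hb), Prod.mk.injEq]
      have hS := card_unmatched_extendAt (b := b) hf ha
      have hT := card_unmatched_extendAt (b := a) hf.swap hb
      rw [hext, ← hS, ← ih (x + 1) _ (by omega) (hf.extendAt ha hb), mul_sum]
      · refine sum_congr rfl fun σ hσ => ?_
        obtain ⟨hσ, h1, h2⟩ := (mem_extensions_extendAt hf (hle ha) (hle hb) σ).1 hσ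
        have hfil : univ.filter (fun y : Fin n => (x : ℕ) ≤ y) =
            insert x (univ.filter (fun y : Fin n => (x : ℕ) + 1 ≤ y)) := by
          ext y
          simp only [mem_filter, mem_univ, true_and, mem_insert]
          omega
        rw [hfil, prod_insert (by simp), localWeight, openSources_eq hf hσ,
          openSources_eq hf.swap (inv_mem_extensions hσ), h1, h2]
      · rw [hS, swap_extendAt, hT, hcard]
        omega
    · intro σ hσ
      refine mem_product.2 ⟨min_mem_insert_unmatched hf hσ, ?_⟩
      have := min_mem_insert_unmatched hf.swap (inv_mem_extensions hσ)
      rwa [inv_inv] at this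

theorem sum_derangements_eq {R : Type*} [CommRing R] (p q u d v : R) (n : ℕ) :
    ∑ σ : Equiv.Perm (Fin n) with ∀ i, σ i ≠ i, ∏ y, localWeight p q u d v σ y =
      completionWeight p q (u + d) v n 0 := by
  have h := sum_extensions_eq p q u d v n 0 (fun _ _ : Fin n => False) (by omega)
    ⟨False.elim, False.elim, False.elim, False.elim⟩ (by simp [unmatched])
  simpa [unmatched, extensions] using h

theorem pext_succ (n : ℕ) (σ : Equiv.Perm (Fin n)) (i : Fin n) :
    pext n σ ((i : ℕ) + 1) = (σ i : ℕ) + 1 := by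
  simp [pext]

theorem Icc_one_eq_map (n : ℕ) :
    Icc 1 n = univ.map (Fin.valEmbedding.trans (addRightEmbedding 1) : Fin n ↪ ℕ) := by
  ext i
  simp only [mem_Icc, mem_map, mem_univ, true_and, Function.Embedding.trans_apply,
    Fin.valEmbedding_apply, addRightEmbedding_apply]
  constructor
  · rintro ⟨h1, h2⟩
    exact ⟨⟨i - 1, by omega⟩, by simp only; omega⟩
  · rintro ⟨j, rfl⟩
    omega

theorem card_filter_Icc_one (n : ℕ) (P : ℕ → Prop) [DecidablePred P] :
    ((Icc 1 n).filter P).card = (univ.filter fun i : Fin n => P ((i : ℕ) + 1)).card := by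
  simp_rw [card_filter, Icc_one_eq_map, sum_map]
  rfl

theorem card_filter_pairs (n : ℕ) (P : ℕ × ℕ → Prop) [DecidablePred P] :
    ((pairs n).filter P).card =
      ∑ j : Fin n, (univ.filter fun i : Fin n => P ((i : ℕ) + 1, (j : ℕ) + 1)).card := by
  simp_rw [card_filter, pairs, sum_product_right, Icc_one_eq_map, sum_map]
  rfl

theorem card_filter_pairs_left (n : ℕ) (P : ℕ × ℕ → Prop) [DecidablePred P] :
    ((pairs n).filter P).card =
      ∑ i : Fin n, (univ.filter fun j : Fin n => P ((i : ℕ) + 1, (j : ℕ) + 1)).card := by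
  simp_rw [card_filter, pairs, sum_product, Icc_one_eq_map, sum_map]
  rfl

/-- The open arcs of `σ` at `y` nesting the arc that ends at `y`. -/
def closeNest {n : ℕ} (σ : Equiv.Perm (Fin n)) (y : Fin n) : ℕ :=
  if σ⁻¹ y < y then ((openSources σ y).filter (· < σ⁻¹ y)).card else 0

/-- The open arcs of `σ` at `y` crossing the arc that ends at `y`. -/
def closeCros {n : ℕ} (σ : Equiv.Perm (Fin n)) (y : Fin n) : ℕ :=
  if σ⁻¹ y < y then ((openSources σ y).filter (σ⁻¹ y < ·)).card else 0

theorem excStat_eq (n : ℕ) (σ : Equiv.Perm (Fin n)) :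
    excStat n σ = (univ.filter fun y => σ⁻¹ y < y).card := by
  rw [excStat, card_filter_Icc_one]
  simp_rw [pext_succ, card_filter, ← Equiv.sum_comp σ (fun y => if σ⁻¹ y < y then 1 else 0)]
  simp

theorem inv_apply_apply {n : ℕ} (σ : Equiv.Perm (Fin n)) (i : Fin n) : σ⁻¹ (σ i) = i :=
  σ.symm_apply_apply i

theorem card_filter_comp_perm {n : ℕ} (σ : Equiv.Perm (Fin n)) (P : Fin n → Prop)
    [DecidablePred P] :
    (univ.filter fun i => P (σ i)).card = (univ.filter P).card := by
  simp_rw [card_filter]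
  exact Equiv.sum_comp σ (fun y => if P y then 1 else 0)

theorem nestStat_eq {n : ℕ} {σ : Equiv.Perm (Fin n)} (hσ : ∀ i, σ i ≠ i) :
    nestStat n σ = ∑ y, (closeNest σ y + closeNest σ⁻¹ y) := by
  rw [nestStat, card_filter_pairs]
  have hsplit : ∀ j : Fin n, (univ.filter fun i : Fin n =>
      ((i : ℕ) + 1 < j + 1 ∧ (j : ℕ) + 1 ≤ pext n σ (j + 1) ∧
        pext n σ (j + 1) < pext n σ (i + 1)) ∨
      ((j : ℕ) + 1 < i + 1 ∧ pext n σ (j + 1) < j + 1 ∧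
        pext n σ (i + 1) < pext n σ (j + 1))).card =
      (univ.filter fun i => i < j ∧ j ≤ σ j ∧ σ j < σ i).card +
        (univ.filter fun i => j < i ∧ σ j < j ∧ σ i < σ j).card := by
    intro j
    rw [← card_union_of_disjoint, ← filter_or]
    · congr 1
      ext i
      simp only [pext_succ, mem_filter, mem_univ, true_and, Fin.lt_def, Fin.le_def]
      omega
    · rw [disjoint_filter]
      rintro i - h1 h2
      exact lt_asymm h1.1 h2.1
  simp only [hsplit, sum_add_distrib]
  congr 1
  · rw [← Equiv.sum_comp σ (closeNest σ)]
    refine sum_congr rfl fun j _ => ?_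
    rw [closeNest, openSources, filter_filter, inv_apply_apply]
    split_ifs with h
    · congr 1
      ext i
      simp only [mem_filter, mem_univ, true_and]
      constructor
      · rintro ⟨h1, h2, h3⟩
        exact ⟨⟨h1.trans h, h3.le⟩, h1⟩
      · rintro ⟨⟨h1, h2⟩, h3⟩
        exact ⟨h3, h.le, lt_of_le_of_ne h2 fun h4 => h3.ne' (σ.injective h4)⟩
    · rw [card_eq_zero, filter_eq_empty_iff]
      rintro i - ⟨-, h2, -⟩
      exact h (lt_of_le_of_ne h2 (hσ j).symm)
  · refine sum_congr rfl fun j _ => ?_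
    rw [closeNest, openSources, filter_filter, inv_inv,
      ← card_filter_comp_perm σ (fun a => (a < j ∧ j ≤ σ⁻¹ a) ∧ a < σ j)]
    split_ifs with h
    · congr 1
      ext i
      simp only [mem_filter, mem_univ, true_and, inv_apply_apply]
      constructor
      · rintro ⟨h1, h2, h3⟩
        exact ⟨⟨h3.trans h, h1.le⟩, h3⟩
      · rintro ⟨⟨h1, h2⟩, h3⟩
        exact ⟨lt_of_le_of_ne h2 fun h4 => h3.ne (by rw [h4]), h, h3⟩
    · rw [card_eq_zero, filter_eq_empty_iff]
      exact fun i _ hi => h hi.2.1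

theorem crosStat_eq {n : ℕ} (σ : Equiv.Perm (Fin n)) :
    crosStat n σ =
      ∑ y, (closeCros σ y + (if σ⁻¹ y < y ∧ y < σ y then 1 else 0) + closeCros σ⁻¹ y) := by
  rw [crosStat, filter_or, card_union_of_disjoint, card_filter_pairs_left, card_filter_pairs,
    sum_add_distrib]
  · simp only [pext_succ]
    congr 1
    · rw [← Equiv.sum_comp σ
        (fun y => closeCros σ y + if σ⁻¹ y < y ∧ y < σ y then 1 else 0)]
      refine sum_congr rfl fun i _ => ?_
      rw [closeCros, openSources, filter_filter, inv_apply_apply]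
      by_cases h : i < σ i
      · have hset : (univ.filter fun j : Fin n => (i : ℕ) + 1 < j + 1 ∧
            (j : ℕ) + 1 ≤ σ i + 1 ∧ (σ i : ℕ) + 1 < σ j + 1) =
            (univ.filter fun j => (j < σ i ∧ σ i ≤ σ j) ∧ i < j) ∪
              (univ.filter fun j => j = σ i ∧ σ i < σ (σ i)) := by
          ext j
          have hij : (i : ℕ) < j → (σ i : ℕ) ≠ σ j := fun h1 h2 =>
            h1.ne (congrArg Fin.val (σ.injective (Fin.ext h2)))
          simp only [mem_filter, mem_univ, true_and, mem_union]
          constructor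
          · rintro ⟨h1, h2, h3⟩
            rcases (show j < σ i ∨ j = σ i by omega) with h4 | rfl
            · exact Or.inl ⟨⟨h4, by omega⟩, by omega⟩
            · exact Or.inr ⟨rfl, by omega⟩
          · rintro (⟨⟨h1, h2⟩, h3⟩ | ⟨rfl, h2⟩)
            · have := hij h3
              omega
            · omega
        rw [hset, card_union_of_disjoint, if_pos h]
        · congr 1
          split_ifs with h'
          · exact card_eq_one.2 ⟨σ i, by ext j; simp [h'.2]⟩
          · have : ¬ σ i < σ (σ i) := fun h2 => h' ⟨h, h2⟩
            simp [this]
        · rw [disjoint_filter]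
          rintro j - ⟨⟨h1, -⟩, -⟩ ⟨h2, -⟩
          exact h1.ne h2
      · rw [if_neg h, if_neg fun h' => h h'.1, card_eq_zero, filter_eq_empty_iff]
        rintro j - ⟨h1, h2, -⟩
        omega
    · refine sum_congr rfl fun j _ => ?_
      rw [closeCros, openSources, filter_filter, inv_inv,
      ← card_filter_comp_perm σ (fun a => (a < j ∧ j ≤ σ⁻¹ a) ∧ σ j < a)]
      split_ifs with h
      · congr 1
        ext i
        have hij : (σ j : ℕ) < σ i → (j : ℕ) ≠ i := fun h1 h2 =>
          h1.ne (by rw [Fin.ext h2])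
        simp only [mem_filter, mem_univ, true_and, inv_apply_apply]
        omega
      · rw [card_eq_zero, filter_eq_empty_iff]
        rintro i - ⟨h1, h2, h3⟩
        omega
  · rw [disjoint_filter]
    rintro x - h1 h2
    exact lt_asymm h1.1 h2.1

theorem prod_localWeight_eq {R : Type*} [CommRing R] {p q q' : R} (hq : q * q' = 1) {n : ℕ}
    {σ : Equiv.Perm (Fin n)} (hσ : ∀ i, σ i ≠ i) :
    ∏ y, localWeight p q (-1) 1 (-q') σ y =
      (-1) ^ excStat n σ * p ^ nestStat n σ * (q ^ crosStat n σ * q' ^ excStat n σ) := by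
  have hσ' : ∀ i, σ⁻¹ i ≠ i := fun i hi => hσ i (Equiv.Perm.inv_eq_iff_eq.1 hi).symm
  rw [excStat_eq, nestStat_eq hσ, crosStat_eq σ, card_filter]
  simp only [← prod_pow_eq_pow_sum, ← prod_mul_distrib]
  refine prod_congr rfl fun y _ => ?_
  simp only [localWeight, closeWeight, typeWeight, closeNest, closeCros, inv_inv]
  rcases lt_or_gt_of_ne (hσ' y) with h1 | h1 <;> rcases lt_or_gt_of_ne (hσ y) with h2 | h2
  · simp only [min_eq_left h1.le, min_eq_left h2.le, h1.ne, h2.ne, h1, h2, h2.not_gt, if_true,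
      if_false, and_false]
    ring
  · simp only [min_eq_left h1.le, min_eq_right h2.le, h1.ne, h1, h2, h2.not_gt, if_true,
      if_false, and_self]
    linear_combination p ^ ((openSources σ y).filter (· < σ⁻¹ y)).card *
      q ^ ((openSources σ y).filter (σ⁻¹ y < ·)).card * hq
  · simp only [min_eq_right h1.le, min_eq_left h2.le, h2.ne, h1.not_gt, h2, h2.not_gt, if_true,
      if_false, and_false]
    ring
  · simp only [min_eq_right h1.le, min_eq_right h2.le, h1.not_gt, h2.not_gt, if_true,
      if_false, false_and]
    ring

theorem prod_localWeight_zero {R : Type*} [CommRing R] (p q u d v : R) {n : ℕ}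
    {σ : Equiv.Perm (Fin n)} (hσ : ∀ i, σ i ≠ i) :
    ∏ y, localWeight p q 0 0 v σ y =
      if ∀ y, σ⁻¹ y < y ↔ σ y < y then ∏ y, localWeight p q u d v σ y else 0 := by
  have hσ' : ∀ i, σ⁻¹ i ≠ i := fun i hi => hσ i (Equiv.Perm.inv_eq_iff_eq.1 hi).symm
  have hmin : ∀ a y : Fin n, a ≠ y → (min a y = y ↔ ¬ a < y) := fun a y h => by
    rw [min_eq_right_iff, not_lt]
  split_ifs with h
  · refine prod_congr rfl fun y _ => ?_
    simp only [localWeight, typeWeight, hmin _ _ (hσ y), hmin _ _ (hσ' y), h y]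
    split_ifs <;> rfl
  · push Not at h
    obtain ⟨y, hy⟩ := h
    refine prod_eq_zero (mem_univ y) ?_
    simp only [localWeight, typeWeight, hmin _ _ (hσ y), hmin _ _ (hσ' y)]
    rcases hy with ⟨h1, h2⟩ | ⟨h1, h2⟩
    · simp only [h1, h2.not_gt, not_true_eq_false, not_false_eq_true, if_true, if_false, mul_zero]
    · simp only [h1.not_gt, h2, not_true_eq_false, not_false_eq_true, if_true, if_false, mul_zero]

theorem fixStat_eq_zero_iff {n : ℕ} {σ : Equiv.Perm (Fin n)} :
    fixStat n σ = 0 ↔ ∀ i, σ i ≠ i := by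
  rw [fixStat, card_filter_Icc_one, card_eq_zero, filter_eq_empty_iff]
  simp [pext_succ, Fin.ext_iff]

theorem excStat_add_card_drops {n : ℕ} {σ : Equiv.Perm (Fin n)} (hσ : ∀ i, σ i ≠ i) :
    excStat n σ + (univ.filter fun y => σ y < y).card = n := by
  have h : excStat n σ = (univ.filter fun y => ¬ σ y < y).card := by
    rw [excStat, card_filter_Icc_one]
    congr 1
    ext y
    have := hσ y
    simp only [pext_succ, mem_filter, mem_univ, true_and]
    omega
  rw [h, add_comm, card_filter_add_card_filter_not, card_univ, Fintype.card_fin]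

theorem two_mul_excStat {n : ℕ} {σ : Equiv.Perm (Fin n)} (hσ : ∀ i, σ i ≠ i)
    (h : ∀ y, σ⁻¹ y < y ↔ σ y < y) : 2 * excStat n σ = n := by
  have h1 := excStat_add_card_drops hσ
  rw [← filter_congr fun y _ => h y, ← excStat_eq] at h1
  omega

theorem no_transient_iff {n : ℕ} (hn : Even n) {σ : Equiv.Perm (Fin n)} (hσ : ∀ i, σ i ≠ i) :
    (∀ y, σ⁻¹ y < y ↔ σ y < y) ↔ cvalleyStat n σ = n / 2 ∧ cdaStat n σ = 0 := by
  have hσ' : ∀ i, σ⁻¹ i ≠ i := fun i hi => hσ i (Equiv.Perm.inv_eq_iff_eq.1 hi).symm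
  have hcda : cdaStat n σ = 0 ↔ ∀ y, σ⁻¹ y < y → σ y < y := by
    rw [cdaStat, card_filter_Icc_one, card_eq_zero, filter_eq_empty_iff]
    simp only [pext_succ, mem_univ, true_imp_iff]
    refine forall_congr' fun y => ?_
    have := hσ y
    omega
  have hval : cdaStat n σ = 0 → cvalleyStat n σ = excStat n σ := by
    rw [hcda, cvalleyStat, excStat, card_filter_Icc_one, card_filter_Icc_one]
    intro h
    congr 1
    ext y
    have := h y
    have := hσ' y
    simp only [pext_succ, mem_filter, mem_univ, true_and]
    omega
  constructor
  · intro h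
    have h0 := hcda.2 fun y => (h y).1
    have := two_mul_excStat hσ h
    exact ⟨by rw [hval h0]; omega, h0⟩
  · rintro ⟨h1, h0⟩
    have h2 := excStat_add_card_drops hσ
    have h3 := hval h0
    have hsub : (univ.filter fun y => σ⁻¹ y < y) ⊆ univ.filter fun y => σ y < y :=
      monotone_filter_right _ fun y _ => hcda.1 h0 y
    have h4 := excStat_eq n σ
    have heq := eq_of_subset_of_card_le hsub (by obtain ⟨k, rfl⟩ := hn; omega)
    intro y
    simpa using Finset.ext_iff.1 heq y

theorem sum_derangements_eq_sum_no_transient (n : ℕ) :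
    ∑ σ : Equiv.Perm (Fin n) with fixStat n σ = 0,
        (-1 : LaurentPolynomial (Polynomial ℤ)) ^ excStat n σ * pL ^ nestStat n σ *
          LaurentPolynomial.T ((crosStat n σ : ℤ) - (excStat n σ : ℤ)) =
      ∑ σ : Equiv.Perm (Fin n) with fixStat n σ = 0 ∧ ∀ y, σ⁻¹ y < y ↔ σ y < y,
        (-1 : LaurentPolynomial (Polynomial ℤ)) ^ excStat n σ * pL ^ nestStat n σ *
          LaurentPolynomial.T ((crosStat n σ : ℤ) - (excStat n σ : ℤ)) := by
  have hq : (LaurentPolynomial.T 1 * LaurentPolynomial.T (-1) :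
      LaurentPolynomial (Polynomial ℤ)) = 1 := by
    rw [← LaurentPolynomial.T_add, add_neg_cancel, LaurentPolynomial.T_zero]
  have hterm : ∀ σ : Equiv.Perm (Fin n), (∀ i, σ i ≠ i) →
      (-1 : LaurentPolynomial (Polynomial ℤ)) ^ excStat n σ * pL ^ nestStat n σ *
        LaurentPolynomial.T ((crosStat n σ : ℤ) - (excStat n σ : ℤ)) =
      ∏ y, localWeight pL (LaurentPolynomial.T 1) (-1) 1 (-LaurentPolynomial.T (-1)) σ y := by
    intro σ hσ
    rw [prod_localWeight_eq hq hσ, LaurentPolynomial.T_pow, LaurentPolynomial.T_pow,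
      ← LaurentPolynomial.T_add, mul_one, mul_neg_one, sub_eq_add_neg]
  rw [← filter_filter, sum_filter (p := fun σ : Equiv.Perm (Fin n) => ∀ y, σ⁻¹ y < y ↔ σ y < y)]
  simp only [fixStat_eq_zero_iff]
  rw [sum_congr rfl fun σ hσ => hterm σ (mem_filter.1 hσ).2, sum_derangements_eq,
    neg_add_cancel, ← add_zero (0 : LaurentPolynomial (Polynomial ℤ)), ← sum_derangements_eq]
  refine sum_congr rfl fun σ hσ => ?_
  rw [prod_localWeight_zero _ _ (-1) 1 _ (mem_filter.1 hσ).2, ← hterm σ (mem_filter.1 hσ).2]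
  simp

open LaurentPolynomial in
theorem statement10 (n : ℕ) (hn : 1 ≤ n) :
    (Odd n →
      (∑ σ ∈ Finset.univ.filter
          (fun σ : Equiv.Perm (Fin n) => fixStat n σ = 0),
        (-1 : LaurentPolynomial (Polynomial ℤ)) ^ excStat n σ *
          pL ^ nestStat n σ *
          T ((crosStat n σ : ℤ) - (excStat n σ : ℤ))) = 0) ∧
    (Even n →
      (∑ σ ∈ Finset.univ.filter
          (fun σ : Equiv.Perm (Fin n) => fixStat n σ = 0),
        (-1 : LaurentPolynomial (Polynomial ℤ)) ^ excStat n σ *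
          pL ^ nestStat n σ *
          T ((crosStat n σ : ℤ) - (excStat n σ : ℤ))) =
      (-1 : LaurentPolynomial (Polynomial ℤ)) ^ (n / 2) * T (-(n / 2 : ℕ)) *
        ∑ σ ∈ Finset.univ.filter
            (fun σ : Equiv.Perm (Fin n) =>
              fixStat n σ = 0 ∧ cvalleyStat n σ = n / 2 ∧ cdaStat n σ = 0),
          pL ^ nestStat n σ * T (crosStat n σ : ℤ)) := by
  rw [sum_derangements_eq_sum_no_transient]
  constructor
  · intro hodd
    rw [filter_false_of_mem, sum_empty]
    rintro σ - ⟨hσ, h⟩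
    have := two_mul_excStat (fixStat_eq_zero_iff.1 hσ) h
    exact Nat.not_even_iff_odd.2 hodd ⟨excStat n σ, by omega⟩
  · intro heven
    rw [mul_sum]
    have hset : (univ.filter fun σ : Equiv.Perm (Fin n) =>
        fixStat n σ = 0 ∧ ∀ y, σ⁻¹ y < y ↔ σ y < y) =
        univ.filter fun σ : Equiv.Perm (Fin n) =>
          fixStat n σ = 0 ∧ cvalleyStat n σ = n / 2 ∧ cdaStat n σ = 0 :=
      filter_congr fun σ _ => and_congr_right fun hσ =>
        no_transient_iff heven (fixStat_eq_zero_iff.1 hσ)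
    rw [← hset]
    refine sum_congr rfl fun σ hσ => ?_
    obtain ⟨-, hσ, h⟩ := mem_filter.1 hσ
    have hexc : excStat n σ = n / 2 := by
      have := two_mul_excStat (fixStat_eq_zero_iff.1 hσ) h
      omega
    rw [hexc, sub_eq_neg_add, T_add]
    ring

end SZpaper
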